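/- arXiv:1701.08121 — 2 statements merged into one kernel-verified Lean document; each statement's English description precedes it below -/
import Mathlib

section
/- Let α : (0,∞) → (0,∞) be a strictly increasing bijection. Suppose that for every n ∈ ℕ there exists a nontrivial word in F₂ of length at most α(n) which is a law for every finite group of order at most n. Let Γ be a free group of finite rank at least 2 with finite generating set S. Then α^{-1} ≼ F_Γ^S. -/
/-- `w` is a law for `G` if the image of `w` under every homomorphism `F₂ → G` is trivial. -/
def IsLaw (G : Type*) [Group G] (w : FreeGroup (Fin 2)) : Prop :=
  ∀ f : FreeGroup (Fin 2) →* G, f w = 1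

/-- `k_Γ(g)`: the minimal order of a finite group `Q` admitting a homomorphism
`π : Γ → Q` with `π g ≠ 1`. -/
noncomputable def kGamma {Γ : Type} [Group Γ] (g : Γ) : ℕ :=
  sInf {m : ℕ | ∃ (Q : Type) (_ : Group Q) (_ : Fintype Q) (π : Γ →* Q),
    π g ≠ 1 ∧ Nat.card Q = m}

/-- `g` lies in the ball of radius `n` in the word metric associated to `S`. -/
def inBall {Γ : Type} [Group Γ] (S : Finset Γ) (n : ℕ) (g : Γ) : Prop :=
  ∃ l : List Γ, l.length ≤ n ∧ (∀ a ∈ l, a ∈ S ∨ a⁻¹ ∈ S) ∧ l.prod = g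

/-- The residual finiteness growth function `F_Γ^S(n)`:
the maximum of `k_Γ(g)` over nontrivial `g` in the ball of radius `n`. -/
noncomputable def rfGrowth {Γ : Type} [Group Γ] (S : Finset Γ) (n : ℕ) : ℕ :=
  sSup {m : ℕ | ∃ g : Γ, g ≠ 1 ∧ inBall S n g ∧ kGamma g = m}

/-- `f₁ ≼ f₂`: there is `C > 0` with `f₁(n) ≤ C · f₂(C·n)` for all positive `n`. -/
def Preceq (f₁ f₂ : ℕ → ℝ) : Prop :=
  ∃ C : ℝ, 0 < C ∧ ∀ n : ℕ, 0 < n → f₁ n ≤ C * f₂ ⌈C * (n : ℝ)⌉₊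

section Balls

variable {Γ : Type} [Group Γ] {S : Finset Γ} {m n : ℕ} {g h : Γ}

theorem inBall.mono (hmn : m ≤ n) (hg : inBall S m g) : inBall S n g := by
  obtain ⟨l, hl, hS, hp⟩ := hg
  exact ⟨l, hl.trans hmn, hS, hp⟩

theorem inBall.one : inBall S 0 (1 : Γ) := ⟨[], by simp⟩

theorem inBall.mul (hg : inBall S m g) (hh : inBall S n h) : inBall S (m + n) (g * h) := by
  obtain ⟨l, hl, hS, rfl⟩ := hg
  obtain ⟨l', hl', hS', rfl⟩ := hh
  refine ⟨l ++ l', by simp; omega, fun a ha => ?_, by simp⟩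
  rcases List.mem_append.1 ha with ha | ha
  exacts [hS a ha, hS' a ha]

theorem inBall.inv (hg : inBall S n g) : inBall S n g⁻¹ := by
  obtain ⟨l, hl, hS, rfl⟩ := hg
  refine ⟨(l.map (·⁻¹)).reverse, by simpa using hl, fun a ha => ?_, by rw [List.prod_inv_reverse]⟩
  simp only [List.mem_reverse, List.mem_map] at ha
  obtain ⟨b, hb, rfl⟩ := ha
  simpa using (hS b hb).symm

theorem exists_inBall (hS : Subgroup.closure (S : Set Γ) = ⊤) (g : Γ) : ∃ n, inBall S n g := by
  have hg : g ∈ Subgroup.closure (S : Set Γ) := hS ▸ Subgroup.mem_top g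
  induction hg using Subgroup.closure_induction with
  | mem x hx => exact ⟨1, [x], by simp, by simpa using Or.inl hx, by simp⟩
  | one => exact ⟨0, inBall.one⟩
  | mul x y _ _ hx hy =>
    obtain ⟨m, hm⟩ := hx
    obtain ⟨n, hn⟩ := hy
    exact ⟨m + n, hm.mul hn⟩
  | inv x _ hx =>
    obtain ⟨n, hn⟩ := hx
    exact ⟨n, hn.inv⟩

theorem finite_setOf_inBall (S : Finset Γ) (n : ℕ) : {g | inBall S n g}.Finite := by
  classical
  let T : Set Γ := S ∪ (S : Set Γ)⁻¹
  have hT : Finite T := (S.finite_toSet.union S.finite_toSet.inv).to_subtype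
  refine ((List.finite_length_le T n).image fun l => (l.map (↑)).prod).subset ?_
  rintro g ⟨l, hl, hS, rfl⟩
  lift l to List T using fun a ha => by simpa [T] using hS a ha
  exact ⟨l, by simpa using hl, rfl⟩

theorem kGamma_le_rfGrowth (hg : g ≠ 1) (hn : inBall S n g) : kGamma g ≤ rfGrowth S n := by
  refine le_csSup (Set.Finite.bddAbove ?_) ⟨g, hg, hn, rfl⟩
  refine ((finite_setOf_inBall S n).image kGamma).subset ?_
  rintro _ ⟨g, -, hg, rfl⟩
  exact ⟨g, hg, rfl⟩

end Balls

/-- The partial action of `s` by left translation on a finite set extends to a permutation. -/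
theorem exists_perm_extending_mul_left {G : Type*} [Group G] (A : Set G) [Finite A] (s : G) :
    ∃ σ : Equiv.Perm A, ∀ (a : A) (h : s * a ∈ A), σ a = ⟨s * a, h⟩ := by
  classical
  have := Fintype.ofFinite A
  let e : {a : A // s * a ∈ A} ≃ {a : A // s⁻¹ * a ∈ A} :=
    { toFun := fun a => ⟨⟨s * a.1, a.2⟩, by simp⟩
      invFun := fun a => ⟨⟨s⁻¹ * a.1, a.2⟩, by simp⟩
      left_inv := fun a => by simp
      right_inv := fun a => by simp }
  exact ⟨e.extendSubtype, fun a h => e.extendSubtype_apply_of_mem a h⟩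

/-- Free groups are residually finite. -/
theorem FreeGroup.exists_finite_quotient {ι : Type} {w : FreeGroup ι} (hw : w ≠ 1) :
    ∃ (Q : Type) (_ : Group Q) (_ : Fintype Q) (π : FreeGroup ι →* Q), π w ≠ 1 := by
  classical
  let A : Set (FreeGroup ι) := FreeGroup.mk '' {L | L ∈ w.toWord.tails}
  have : Finite A := (w.toWord.tails.finite_toSet.image _).to_subtype
  have := Fintype.ofFinite A
  choose σ hσ using fun i => exists_perm_extending_mul_left A (FreeGroup.of i)
  have hA : ∀ L, L <:+ w.toWord → FreeGroup.mk L ∈ A := fun L hL =>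
    ⟨L, by simpa using hL, rfl⟩
  let o : A := ⟨1, hA [] (List.nil_suffix)⟩
  have key : ∀ L (hL : L <:+ w.toWord),
      FreeGroup.lift σ (FreeGroup.mk L) o = ⟨FreeGroup.mk L, hA L hL⟩ := by
    intro L
    induction L with
    | nil => intro hL; rfl
    | cons x L ih =>
      intro hL
      have hL' := (List.suffix_cons x L).trans hL
      have hmul : FreeGroup.mk (x :: L) = FreeGroup.mk [x] * FreeGroup.mk L := by
        simp [FreeGroup.mul_mk]
      have hmem := hA _ hL
      obtain ⟨i, b⟩ := x
      have hx : FreeGroup.lift σ (FreeGroup.mk ((i, b) :: L)) o =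
          FreeGroup.lift σ (FreeGroup.mk [(i, b)]) ⟨FreeGroup.mk L, hA L hL'⟩ := by
        rw [hmul, _root_.map_mul, Equiv.Perm.mul_apply, ih hL']
      rw [hx]
      cases b with
      | true =>
        have hmul' : FreeGroup.mk ((i, true) :: L) = FreeGroup.of i * FreeGroup.mk L := hmul
        simp only [hmul'] at hmem ⊢
        simpa [FreeGroup.lift_mk] using hσ i ⟨FreeGroup.mk L, hA L hL'⟩ hmem
      | false =>
        have hmul' : FreeGroup.of i * FreeGroup.mk ((i, false) :: L) = FreeGroup.mk L := by
          rw [hmul, ← mul_assoc]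
          have : FreeGroup.mk [(i, false)] = (FreeGroup.of i)⁻¹ := rfl
          simp [this]
        have h := hσ i ⟨FreeGroup.mk ((i, false) :: L), hmem⟩ (by
          simpa only [hmul'] using hA L hL')
        simp only [hmul'] at h
        rw [← h]
        simp [FreeGroup.lift_mk]
  refine ⟨Equiv.Perm A, inferInstance, inferInstance, FreeGroup.lift σ, fun h => hw ?_⟩
  have hkey := key _ List.suffix_rfl
  simp only [FreeGroup.mk_toWord, h] at hkey
  exact (congrArg Subtype.val hkey).symm

theorem FreeGroup.lt_kGamma {ι : Type} {w : FreeGroup ι} (hw : w ≠ 1) {m : ℕ}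
    (h : ∀ (Q : Type) [Group Q] [Fintype Q], Nat.card Q ≤ m → ∀ π : FreeGroup ι →* Q, π w = 1) :
    m < kGamma w := by
  obtain ⟨Q, hQ, hF, π, hπ⟩ := FreeGroup.exists_finite_quotient hw
  obtain ⟨Q, _, _, π, hπ, hc⟩ := Nat.sInf_mem (s := {m : ℕ | ∃ (Q : Type) (_ : Group Q)
    (_ : Fintype Q) (π : FreeGroup ι →* Q), π w ≠ 1 ∧ Nat.card Q = m}) ⟨_, Q, hQ, hF, π, hπ, rfl⟩
  by_contra! hm
  exact hπ (h Q (hc.trans_le hm) π)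

theorem FreeGroup.inBall_map {ι Γ : Type} [DecidableEq ι] [Group Γ] {S : Finset Γ} {C : ℕ}
    (f : FreeGroup ι →* Γ) (hC : ∀ i, inBall S C (f (FreeGroup.of i))) (w : FreeGroup ι) :
    inBall S (C * w.toWord.length) (f w) := by
  have key : ∀ L : List (ι × Bool), inBall S (C * L.length) (f (FreeGroup.mk L)) := by
    intro L
    induction L with
    | nil => simpa [← FreeGroup.one_eq_mk] using inBall.one
    | cons x L ih =>
      obtain ⟨i, b⟩ := x
      have hx : inBall S C (f (FreeGroup.mk [(i, b)])) := by
        cases b with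
        | true => exact hC i
        | false =>
          have : FreeGroup.mk [(i, false)] = (FreeGroup.of i)⁻¹ := rfl
          simpa [this] using (hC i).inv
      have hmul : FreeGroup.mk ((i, b) :: L) = FreeGroup.mk [(i, b)] * FreeGroup.mk L := by
        simp [FreeGroup.mul_mk]
      rw [hmul, _root_.map_mul]
      exact (hx.mul ih).mono (by simp; ring_nf; rfl)
  simpa [FreeGroup.mk_toWord] using key w.toWord

theorem statement7 (α β : ℝ → ℝ)
    (hαpos : ∀ x ∈ Set.Ioi (0 : ℝ), α x ∈ Set.Ioi (0 : ℝ))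
    (hαmono : StrictMonoOn α (Set.Ioi (0 : ℝ)))
    (hαbij : Set.BijOn α (Set.Ioi (0 : ℝ)) (Set.Ioi (0 : ℝ)))
    (hβ : ∀ x ∈ Set.Ioi (0 : ℝ), β x ∈ Set.Ioi (0 : ℝ) ∧ α (β x) = x ∧ β (α x) = x)
    (hlaws : ∀ n : ℕ, ∃ w : FreeGroup (Fin 2), w ≠ 1 ∧ (w.toWord.length : ℝ) ≤ α n ∧
      ∀ (G : Type) [Group G] [Fintype G], Nat.card G ≤ n → IsLaw G w)
    (k : ℕ) (hk : 2 ≤ k) (S : Finset (FreeGroup (Fin k)))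
    (hS : Subgroup.closure (S : Set (FreeGroup (Fin k))) = ⊤) :
    Preceq (fun n => β n) (fun n => (rfGrowth S n : ℝ)) := by
  let f : FreeGroup (Fin 2) →* FreeGroup (Fin k) := FreeGroup.map (Fin.castLE hk)
  have hf : Function.Injective f := FreeGroup.map_injective (Fin.castLE_injective hk)
  choose c hc using fun i : Fin 2 => exists_inBall hS (f (FreeGroup.of i))
  let C := c 0 + c 1 + 1
  have hC : ∀ i, inBall S C (f (FreeGroup.of i)) := fun i =>
    (hc i).mono (by fin_cases i <;> simp [C] <;> omega)
  refine ⟨C, by positivity, fun n hn => ?_⟩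
  obtain ⟨hβpos, hαβ, -⟩ := hβ n (by simpa using hn)
  have hword : ∃ w : FreeGroup (Fin 2), w ≠ 1 ∧ w.toWord.length ≤ n ∧
      ∀ (G : Type) [Group G] [Fintype G], Nat.card G ≤ ⌊β n⌋₊ → IsLaw G w := by
    rcases Nat.eq_zero_or_pos ⌊β n⌋₊ with h0 | hpos
    · refine ⟨FreeGroup.of 0, FreeGroup.of_ne_one 0, by simpa using Nat.one_le_of_lt hn, fun G _ _ hG => ?_⟩
      have : 0 < Nat.card G := Nat.card_pos
      omega
    · obtain ⟨w, hw, hlen, hlaw⟩ := hlaws ⌊β n⌋₊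
      refine ⟨w, hw, ?_, hlaw⟩
      have : α ⌊β n⌋₊ ≤ α (β n) := hαmono.monotoneOn (by simpa using hpos) hβpos
        (Nat.floor_le hβpos.le)
      exact_mod_cast hlen.trans (this.trans hαβ.le)
  obtain ⟨w, hw, hlen, hlaw⟩ := hword
  have hfw : f w ≠ 1 := (map_ne_one_iff f hf).2 hw
  have hlt : ⌊β n⌋₊ < kGamma (f w) :=
    FreeGroup.lt_kGamma hfw fun Q _ _ hQ π => hlaw Q hQ (π.comp f)
  have hle : kGamma (f w) ≤ rfGrowth S (C * n) :=
    kGamma_le_rfGrowth hfw ((FreeGroup.inBall_map f hC w).mono (Nat.mul_le_mul_left C hlen))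
  have hceil : ⌈(C : ℝ) * (n : ℝ)⌉₊ = C * n := by rw [← Nat.cast_mul, Nat.ceil_natCast]
  have hβle : β n ≤ rfGrowth S (C * n) :=
    ((Nat.lt_floor_add_one _).le).trans (by exact_mod_cast hlt.trans_le hle)
  have hC1 : (1 : ℝ) ≤ C := by simp [C]; positivity
  simp only [hceil]
  exact hβle.trans (le_mul_of_one_le_left (Nat.cast_nonneg _) hC1)
end

section
/- There exists a constant C > 0 such that for every integer n ≥ 2 there exists a nontrivial word w_n in the free group F₂ of length at most C · n^{2/3} · (log n)³ such that for every finite group G with |G| ≤ n which is isomorphic to PSL₂(q) for some prime power q, the word w_n is a law for G. -/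
/-- The projective special linear group `PSL_d(F)`: the quotient of `SL_d(F)` by its center. -/
abbrev PSL (d : ℕ) (F : Type) [Field F] : Type :=
  Matrix.SpecialLinearGroup (Fin d) F ⧸ Subgroup.center (Matrix.SpecialLinearGroup (Fin d) F)

namespace FreeGroup

lemma subsingleton_of_mem_center {α : Type*} {w : FreeGroup α} (hw : w ≠ 1)
    (hc : ∀ i, Commute w (of i)) : Subsingleton α := by
  classical
  by_contra hα
  rw [not_subsingleton_iff_nontrivial] at hα
  obtain ⟨a, L, hL⟩ : ∃ a L, w.toWord = a :: L := by
    rcases h : w.toWord with _ | ⟨a, L⟩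
    · exact absurd (toWord_eq_nil_iff.1 h) hw
    · exact ⟨a, L, rfl⟩
  obtain ⟨k, hk⟩ := exists_ne a.1
  have h1 : (of k * w).toWord = (k, true) :: w.toWord := by
    rw [toWord_mul, toWord_of, List.singleton_append]
    apply IsReduced.reduce_eq
    rw [hL]
    refine isReduced_cons_cons.2 ⟨fun h => absurd h hk, hL ▸ isReduced_toWord⟩
  have h2 : (w * of k).toWord = w.toWord ++ [(k, true)] := by
    have := toWord_mul_sublist w (of k)
    rw [toWord_of] at this
    refine this.eq_of_length ?_
    rw [(hc k).eq, h1]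
    simp
  rw [(hc k).eq, h1, hL] at h2
  simp only [List.cons_append, List.cons.injEq] at h2
  exact hk (by rw [← h2.1])

lemma exists_zpow_of_subsingleton {α : Type*} [Subsingleton α] :
    ∃ d : FreeGroup α, ∀ x, ∃ n : ℤ, x = d ^ n := by
  rcases isEmpty_or_nonempty α with h | ⟨⟨i⟩⟩
  · exact ⟨1, fun x => ⟨0, Subsingleton.elim _ _⟩⟩
  · refine ⟨of i, fun x => ?_⟩
    induction x using FreeGroup.induction_on with
    | C1 => exact ⟨0, by simp⟩
    | of j => exact ⟨1, by rw [Subsingleton.elim j i]; simp⟩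
    | inv_of j _ => exact ⟨-1, by rw [Subsingleton.elim j i]; simp⟩
    | mul x y hx hy =>
      obtain ⟨m, rfl⟩ := hx
      obtain ⟨n, rfl⟩ := hy
      exact ⟨m + n, (zpow_add _ _ _).symm⟩

/-- Centralizers of nontrivial elements of a free group are cyclic. -/
lemma exists_zpow_of_commute {α : Type*} {c : FreeGroup α} (hc : c ≠ 1) :
    ∃ d : FreeGroup α, ∀ x, Commute x c → ∃ n : ℤ, x = d ^ n := by
  let H := Subgroup.centralizer {c}
  have hcH : c ∈ H := Subgroup.mem_centralizer_singleton_iff.2 rfl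
  let e := IsFreeGroup.toFreeGroup H
  have hs : Subsingleton (IsFreeGroup.Generators H) := by
    refine subsingleton_of_mem_center (w := e ⟨c, hcH⟩) ?_ fun i => ?_
    · intro h
      rw [map_eq_one_iff e e.injective] at h
      exact hc (congrArg Subtype.val h)
    · obtain ⟨y, hy⟩ := e.surjective (of i)
      rw [← hy]
      refine Commute.map (Subtype.ext ?_) e
      exact (Subgroup.mem_centralizer_singleton_iff.1 y.2).symm
  obtain ⟨d, hd⟩ := exists_zpow_of_subsingleton (α := IsFreeGroup.Generators H)
  refine ⟨(e.symm d : H), fun x hx => ?_⟩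
  obtain ⟨n, hn⟩ := hd (e ⟨x, Subgroup.mem_centralizer_singleton_iff.2 hx⟩)
  refine ⟨n, ?_⟩
  rw [← Subgroup.coe_zpow, ← map_zpow, ← hn, e.symm_apply_apply]

lemma commute_trans {α : Type*} {a b c : FreeGroup α} (hc : c ≠ 1)
    (ha : Commute a c) (hb : Commute b c) : Commute a b := by
  obtain ⟨d, hd⟩ := exists_zpow_of_commute hc
  obtain ⟨m, rfl⟩ := hd a ha
  obtain ⟨n, rfl⟩ := hd b hb
  exact (Commute.refl d).zpow_zpow m n

lemma commute_of_commute_conj {α : Type*} {x c : FreeGroup α} (hc : c ≠ 1)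
    (h : Commute (x * c * x⁻¹) c) : Commute x c := by
  rcases eq_or_ne x 1 with rfl | hx
  · exact Commute.one_left c
  obtain ⟨d, hd⟩ := exists_zpow_of_commute hc
  obtain ⟨m, hm⟩ := hd c (Commute.refl c)
  have hdc : Commute d c := hm ▸ (Commute.refl d).zpow_right m
  have hd1 : d ≠ 1 := by rintro rfl; exact hc (by simpa using hm)
  have conj (y : FreeGroup α) (hy : Commute (y * c * y⁻¹) c) : ∃ k : ℤ, y * d * y⁻¹ = d ^ k := by
    refine hd _ (commute_trans (c := y * c * y⁻¹) (by simpa using hc) ?_ hy.symm)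
    exact (Commute.conj_iff y).2 hdc
  obtain ⟨k, hk⟩ := conj x h
  obtain ⟨l, hl⟩ := conj x⁻¹ (by
    have := (Commute.conj_iff x⁻¹).2 h.symm
    simpa [mul_assoc] using this)
  have hkl : d ^ (k * l) = d ^ (1 : ℤ) := by
    rw [zpow_mul, ← hk, conj_zpow, ← hl]
    group
  have hkl' : k * l = 1 := injective_zpow_iff_not_isOfFinOrder.2
    (not_isOfFinOrder_of_isMulTorsionFree hd1) hkl
  have hx2 : Commute d (x ^ 2) := by
    have h2 : x ^ 2 * d * (x ^ 2)⁻¹ = d := by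
      have : x ^ 2 * d * (x ^ 2)⁻¹ = x * (x * d * x⁻¹) * x⁻¹ := by
        rw [pow_two]; group
      rw [this, hk, ← conj_zpow, hk, ← zpow_mul]
      rcases Int.eq_one_or_neg_one_of_mul_eq_one hkl' with rfl | rfl <;> simp
    exact (mul_inv_eq_iff_eq_mul.1 h2).symm
  have hxd : Commute x d := commute_trans (c := x ^ 2)
    (fun h => hx (by simpa using h)) ((Commute.refl x).pow_right 2) hx2
  exact hm ▸ hxd.zpow_right m

/-- One of three short commutators of conjugates of nontrivial elements is nontrivial. -/
lemma exists_not_commute_conj {α : Type*} {v w x y : FreeGroup α} (hv : v ≠ 1) (hw : w ≠ 1)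
    (hxy : ¬ Commute x y) :
    ∃ z, (z = 1 ∨ z = x ∨ z = y) ∧ ¬ Commute v (z * w * z⁻¹) := by
  by_contra! H
  have h1 : Commute w v := by simpa using (H 1 (by simp)).symm
  have key (z : FreeGroup α) (hz : Commute v (z * w * z⁻¹)) : Commute z w :=
    commute_of_commute_conj hw (commute_trans hv hz.symm h1)
  exact hxy (commute_trans hw (key x (H x (by simp))) (key y (H y (by simp))))

end FreeGroup

open FreeGroup in
/-- Two nontrivial words admit a short nontrivial common consequence. -/
lemma exists_common_consequence {v w : FreeGroup (Fin 2)} (hv : v ≠ 1) (hw : w ≠ 1) :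
    ∃ u : FreeGroup (Fin 2), u ≠ 1 ∧ u.norm ≤ 2 * (v.norm + w.norm) + 4 ∧
      ∀ (G : Type) [Group G] (f : FreeGroup (Fin 2) →* G), (f v = 1 ∨ f w = 1) → f u = 1 := by
  have hxy : ¬ Commute (of (0 : Fin 2)) (of 1) := by
    intro h
    have := congrArg toWord h.eq
    revert this
    decide
  obtain ⟨z, hz, hvz⟩ := exists_not_commute_conj hv hw hxy
  have hzn : z.norm ≤ 1 := by
    rcases hz with rfl | rfl | rfl <;> simp
  refine ⟨v * (z * w * z⁻¹) * v⁻¹ * (z * w * z⁻¹)⁻¹, ?_, ?_, ?_⟩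
  · intro h
    exact hvz (mul_inv_eq_iff_eq_mul.1 (mul_inv_eq_one.1 h))
  · have h1 := norm_mul_le z w
    have h2 := norm_mul_le (z * w) z⁻¹
    have h3 := norm_mul_le v (z * w * z⁻¹)
    have h4 := norm_mul_le (v * (z * w * z⁻¹)) v⁻¹
    have h5 := norm_mul_le (v * (z * w * z⁻¹) * v⁻¹) (z * w * z⁻¹)⁻¹
    rw [norm_inv_eq] at h2 h4 h5
    omega
  · rintro G _ f (h | h) <;> simp [h]

open FreeGroup in
/-- Any `2 ^ t` nontrivial words of length at most `ℓ` admit a nontrivial common consequence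
of length less than `4 ^ t * (ℓ + 2)`. -/
lemma exists_common_consequence_of_family (ℓ t : ℕ) (ws : ℕ → FreeGroup (Fin 2))
    (h1 : ∀ i, ws i ≠ 1) (hn : ∀ i, (ws i).norm ≤ ℓ) :
    ∃ u : FreeGroup (Fin 2), u ≠ 1 ∧ u.norm + 2 ≤ 4 ^ t * (ℓ + 2) ∧
      ∀ (G : Type) [Group G] (f : FreeGroup (Fin 2) →* G),
        (∃ i < 2 ^ t, f (ws i) = 1) → f u = 1 := by
  induction t generalizing ws with
  | zero =>
    refine ⟨ws 0, h1 0, by simpa using hn 0, ?_⟩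
    rintro G _ f ⟨i, hi, h⟩
    obtain rfl : i = 0 := by simpa using hi
    exact h
  | succ t ih =>
    obtain ⟨u, hu, hun, hf⟩ := ih ws h1 hn
    obtain ⟨v, hv, hvn, hg⟩ := ih (fun i => ws (i + 2 ^ t)) (fun i => h1 _) (fun i => hn _)
    obtain ⟨w, hw, hwn, hh⟩ := exists_common_consequence hu hv
    refine ⟨w, hw, by rw [pow_succ, mul_right_comm]; omega, ?_⟩
    rintro G _ f ⟨i, hi, h⟩
    apply hh
    rcases lt_or_ge i (2 ^ t) with hit | hit
    · exact .inl (hf G f ⟨i, hit, h⟩)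
    · refine .inr (hg G f ⟨i - 2 ^ t, by rw [pow_succ] at hi; omega, ?_⟩)
      simpa [Nat.sub_add_cancel hit] using h

open FreeGroup commutatorElement in
/-- A noncommuting pair satisfies a short nontrivial word in the second derived subgroup. -/
lemma exists_metabelian_word {x b : FreeGroup (Fin 2)} (hxb : ¬ Commute x b) :
    ∃ w : FreeGroup (Fin 2), w ≠ 1 ∧ w.norm ≤ 12 * (x.norm + b.norm) ∧
      ∀ (G : Type) [Group G] (f : FreeGroup (Fin 2) →* G),
        (∀ z, z = 1 ∨ z = f x ∨ z = f b → Commute ⁅f x, f b⁆ (z * ⁅f x, f b⁆ * z⁻¹)) →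
        f w = 1 := by
  have hc : ⁅x, b⁆ ≠ 1 := fun h => hxb (commutatorElement_eq_one_iff_commute.1 h)
  obtain ⟨z, hz, hcz⟩ := exists_not_commute_conj hc hc hxb
  refine ⟨⁅⁅x, b⁆, z * ⁅x, b⁆ * z⁻¹⁆, fun h => hcz (commutatorElement_eq_one_iff_commute.1 h),
    ?_, ?_⟩
  · have hzn : z.norm ≤ x.norm + b.norm := by
      rcases hz with rfl | rfl | rfl <;> simp
    have hcomm (p q : FreeGroup (Fin 2)) : ⁅p, q⁆.norm ≤ 2 * (p.norm + q.norm) := by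
      rw [commutatorElement_def]
      have h1 := norm_mul_le p q
      have h2 := norm_mul_le (p * q) p⁻¹
      have h3 := norm_mul_le (p * q * p⁻¹) q⁻¹
      rw [norm_inv_eq] at h2 h3
      omega
    have h1 := hcomm x b
    have h2 := norm_mul_le z ⁅x, b⁆
    have h3 := norm_mul_le (z * ⁅x, b⁆) z⁻¹
    have h4 := hcomm ⁅x, b⁆ (z * ⁅x, b⁆ * z⁻¹)
    rw [norm_inv_eq] at h3
    omega
  · intro G _ f h
    have := h (f z) (by rcases hz with rfl | rfl | rfl <;> simp)
    simpa [map_commutatorElement] using commutatorElement_eq_one_iff_commute.2 this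

/-- The element obtained from the binary expansion of `i` by Horner's scheme, where conjugation by
`a` plays the role of doubling and multiplication by `b` that of adding one. -/
def hornerWord {G : Type*} [Group G] (a b : G) (i : ℕ) : G :=
  if i = 0 then 1 else a * hornerWord a b (i / 2) * a⁻¹ * b ^ (i % 2)
termination_by i
decreasing_by omega

lemma map_hornerWord {G H : Type*} [Group G] [Group H] (f : G →* H) (a b : G) (i : ℕ) :
    f (hornerWord a b i) = hornerWord (f a) (f b) i := by
  induction i using Nat.strong_induction_on with
  | _ i ih =>
    rw [hornerWord, hornerWord.eq_def (f a)]
    split_ifs with h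
    · simp
    · simp [ih (i / 2) (by omega)]

lemma hornerWord_eq_pow {G : Type*} [Group G] {a b : G} (h : a * b * a⁻¹ = b ^ 2) (i : ℕ) :
    hornerWord a b i = b ^ i := by
  induction i using Nat.strong_induction_on with
  | _ i ih =>
    rw [hornerWord]
    split_ifs with h0
    · simp [h0]
    · rw [ih (i / 2) (by omega), ← conj_pow, h, ← pow_mul, ← pow_add, Nat.div_add_mod]

lemma norm_hornerWord_le {α : Type*} [DecidableEq α] (a b : FreeGroup α) (L i : ℕ)
    (hi : i < 2 ^ L) : (hornerWord a b i).norm ≤ L * (2 * a.norm + b.norm) := by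
  induction L generalizing i with
  | zero =>
    obtain rfl : i = 0 := by simpa using hi
    simp [hornerWord]
  | succ L ih =>
    rw [hornerWord]
    split_ifs with h0
    · simp
    · have h := ih (i / 2) (by rw [pow_succ] at hi; omega)
      have h1 := FreeGroup.norm_mul_le a (hornerWord a b (i / 2))
      have h2 := FreeGroup.norm_mul_le (a * hornerWord a b (i / 2)) a⁻¹
      have h3 := FreeGroup.norm_mul_le (a * hornerWord a b (i / 2) * a⁻¹) (b ^ (i % 2))
      have h4 : (b ^ (i % 2)).norm ≤ b.norm := by
        rcases Nat.mod_two_eq_zero_or_one i with h | h <;> simp [h]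
      rw [FreeGroup.norm_inv_eq] at h2
      rw [Nat.succ_mul]
      omega

open FreeGroup in
/-- Two exponentially growing families of words whose nontrivial differences never commute. -/
lemma exists_families (L : ℕ) :
    ∃ u v : Fin (2 ^ L) → FreeGroup (Fin 2),
      (∀ i, (u i).norm ≤ 3 * L) ∧ (∀ i, (v i).norm ≤ 18 * L) ∧
      ∀ i j k l, i ≠ j → k ≠ l → ¬ Commute ((u i)⁻¹ * u j) ((v k)⁻¹ * v l) := by
  let x : FreeGroup (Fin 2) := of 0
  let y : FreeGroup (Fin 2) := of 1
  let α := x * y * x⁻¹ * y⁻¹ * y⁻¹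
  let β := y * x * y * x⁻¹ * y⁻¹ * x * y⁻¹ * x⁻¹
  let φ : FreeGroup (Fin 2) →* Equiv.Perm ℚ :=
    lift ![Equiv.mulLeft₀ 2 two_ne_zero, Equiv.addRight 1]
  let ψ : FreeGroup (Fin 2) →* Equiv.Perm ℚ :=
    lift ![Equiv.addRight 1, Equiv.mulLeft₀ 2⁻¹ (by norm_num)]
  have φx : φ x = Equiv.mulLeft₀ 2 two_ne_zero := by simp [φ, x]
  have φy : φ y = Equiv.addRight 1 := by simp [φ, y]
  have ψx : ψ x = Equiv.addRight 1 := by simp [ψ, x]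
  have ψy : ψ y = Equiv.mulLeft₀ 2⁻¹ (by norm_num) := by simp [ψ, y]
  have φxy : φ x * φ y * (φ x)⁻¹ = φ y ^ 2 := by
    ext t
    simp [φx, φy, pow_two, Equiv.Perm.mul_apply, Equiv.Perm.inv_def, Equiv.mulLeft₀]
    ring
  have φα : φ α = 1 := by
    simp only [α, _root_.map_mul, _root_.map_inv]
    rw [φxy, pow_two]; group
  have φβ : φ β = 1 := by
    have : φ β = φ y * (φ x * φ y * (φ x)⁻¹) * (φ y)⁻¹ * (φ x * φ y * (φ x)⁻¹)⁻¹ := by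
      simp only [β, _root_.map_mul, _root_.map_inv]; group
    rw [this, φxy, pow_two]; group
  have ψβ (t : ℚ) : ψ β t = t - 1 / 4 := by
    simp [β, ψx, ψy, Equiv.Perm.mul_apply, Equiv.Perm.inv_def, Equiv.mulLeft₀]
    ring
  have ψα (t : ℚ) : ψ α t = 2 * t + 1 / 2 := by
    simp [α, ψx, ψy, Equiv.Perm.mul_apply, Equiv.Perm.inv_def, Equiv.mulLeft₀]
    ring
  have ψαβ : ψ α * ψ β * (ψ α)⁻¹ = ψ β ^ 2 := by
    rw [mul_inv_eq_iff_eq_mul]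
    ext t
    simp only [pow_two, Equiv.Perm.mul_apply, ψα, ψβ]
    ring
  have φy_pow (n : ℕ) : (φ y ^ n) 0 = n := by
    induction n with
    | zero => simp
    | succ n ih => rw [pow_succ', Equiv.Perm.mul_apply, ih, φy]; simp
  have ψβ_pow (n : ℕ) : (ψ β ^ n) 0 = - n / 4 := by
    induction n with
    | zero => simp
    | succ n ih => rw [pow_succ', Equiv.Perm.mul_apply, ih, ψβ]; push_cast; ring
  refine ⟨fun i => hornerWord x y i, fun i => hornerWord α β i, fun i => ?_, fun i => ?_, ?_⟩
  · refine (norm_hornerWord_le x y L i i.2).trans ?_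
    simp [x, y, mul_comm]
  · refine (norm_hornerWord_le α β L i i.2).trans ?_
    have hα : α.norm = 5 := by decide
    have hβ : β.norm = 8 := by decide
    rw [hα, hβ, mul_comm]
  · intro i j k l hij hkl hcomm
    have hv : (hornerWord α β k)⁻¹ * hornerWord α β l ≠ 1 := by
      intro h
      have h := congrArg (fun g => ψ g 0) (inv_mul_eq_one.1 h)
      simp only [map_hornerWord, hornerWord_eq_pow ψαβ, ψβ_pow] at h
      refine hkl (Fin.ext ?_)
      have : ((k : ℕ) : ℚ) = (l : ℕ) := by linarith
      exact_mod_cast this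
    have hφv (n : ℕ) : φ (hornerWord α β n) = 1 := by
      rw [map_hornerWord, φα, φβ, hornerWord_eq_pow (by simp), one_pow]
    obtain ⟨d, hd⟩ := exists_zpow_of_commute hv
    obtain ⟨m, hm⟩ := hd _ hcomm
    obtain ⟨n, hn⟩ := hd _ (Commute.refl _)
    have hn0 : n ≠ 0 := by rintro rfl; exact hv (by simpa using hn)
    have h1 : ((hornerWord x y i)⁻¹ * hornerWord x y j) ^ n =
        ((hornerWord α β k)⁻¹ * hornerWord α β l) ^ m := by
      rw [hm, hn, ← zpow_mul, ← zpow_mul, mul_comm]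
    have h2 := congrArg φ h1
    simp only [map_zpow, _root_.map_mul, _root_.map_inv, hφv, map_hornerWord,
      hornerWord_eq_pow φxy] at h2
    rw [inv_one, one_mul, one_zpow, ← zpow_natCast, ← zpow_natCast, ← zpow_neg, ← zpow_add,
      ← zpow_mul] at h2
    have hfin : ¬ IsOfFinOrder (φ y) := by
      rw [isOfFinOrder_iff_pow_eq_one]
      rintro ⟨e, he, h⟩
      have := φy_pow e
      rw [h, Equiv.Perm.one_apply] at this
      exact he.ne' (by exact_mod_cast this.symm)
    have h3 := injective_zpow_iff_not_isOfFinOrder.2 hfin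
      (h2.trans (zpow_zero (φ y)).symm)
    rcases mul_eq_zero.1 h3 with h | h
    · exact hij (Fin.ext (by omega))
    · exact hn0 h

section SpecialLinear

open Matrix Projectivization
open scoped LinearAlgebra.Projectivization MatrixGroups commutatorElement

variable {F : Type*} [Field F]

lemma exists_eigenvalue_of_smul_eq {g : SL(2, F)} {v : Fin 2 → F} (hv : v ≠ 0)
    (h : g • Projectivization.mk F v hv = Projectivization.mk F v hv) :
    ∃ a : Fˣ, g • v = a • v := by
  rw [smul_mk, mk_eq_mk_iff] at h
  obtain ⟨a, ha⟩ := h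
  exact ⟨a, ha.symm⟩

lemma commute_of_smul_eq {g h : SL(2, F)} {v : Fin 2 → F} (hv : v ≠ 0)
    (hg : g • v = v) (hh : h • v = v) : Commute g h := by
  have hdg := g.det_coe
  have hdh := h.det_coe
  rw [Matrix.det_fin_two] at hdg hdh
  have hg0 := congrFun hg 0
  have hg1 := congrFun hg 1
  have hh0 := congrFun hh 0
  have hh1 := congrFun hh 1
  have hv' : v 0 ≠ 0 ∨ v 1 ≠ 0 := by
    by_contra! H
    exact hv (funext fun i => by fin_cases i; exacts [H.1, H.2])
  simp only [Matrix.SpecialLinearGroup.smul_def, Matrix.smul_eq_mulVec, Matrix.mulVec,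
    dotProduct, Fin.sum_univ_two] at hg0 hg1 hh0 hh1
  refine Subtype.ext ?_
  change g.1 * h.1 = h.1 * g.1
  ext i j
  fin_cases i <;> fin_cases j <;> simp [Matrix.mul_apply, Fin.sum_univ_two] <;> grind

/-- Commutators of elements fixing a common point of the projective line generate an abelian
group. -/
lemma commute_commutator_conj_of_smul_eq {x b : SL(2, F)} {p : ℙ F (Fin 2 → F)}
    (hx : x • p = p) (hb : b • p = p) (z : SL(2, F)) (hz : z = 1 ∨ z = x ∨ z = b) :
    Commute ⁅x, b⁆ (z * ⁅x, b⁆ * z⁻¹) := by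
  induction p using Projectivization.ind with
  | _ v hv =>
  obtain ⟨s, hs⟩ := exists_eigenvalue_of_smul_eq hv hx
  obtain ⟨t, ht⟩ := exists_eigenvalue_of_smul_eq hv hb
  obtain ⟨r, hr⟩ : ∃ r : Fˣ, z • v = r • v := by
    rcases hz with rfl | rfl | rfl
    exacts [⟨1, by simp⟩, ⟨s, hs⟩, ⟨t, ht⟩]
  have inv {g : SL(2, F)} {a : Fˣ} (h : g • v = a • v) : g⁻¹ • v = a⁻¹ • v := by
    rw [inv_smul_eq_iff, smul_comm, h, inv_smul_smul]
  have hc : ⁅x, b⁆ • v = v := by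
    rw [commutatorElement_def, mul_smul, mul_smul, mul_smul, inv ht, smul_comm x⁻¹, inv hs,
      smul_comm b, smul_comm b, ht, smul_comm x, smul_comm x, smul_comm x, hs]
    simp only [smul_smul]
    rw [show t⁻¹ * (s⁻¹ * (t * s)) = 1 by group; simp [mul_comm], one_smul]
  refine commute_of_smul_eq hv hc ?_
  rw [mul_smul, mul_smul, inv hr, smul_comm ⁅x, b⁆, hc, smul_comm z, hr, inv_smul_smul]

lemma det_ne_zero_of_mk_ne {u v : Fin 2 → F} {hu : u ≠ 0} {hv : v ≠ 0}
    (h : Projectivization.mk F u hu ≠ Projectivization.mk F v hv) :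
    u 0 * v 1 - u 1 * v 0 ≠ 0 := by
  intro hd
  apply h
  rw [mk_eq_mk_iff']
  have hv' : v 0 ≠ 0 ∨ v 1 ≠ 0 := by
    by_contra! H
    exact hv (funext fun i => by fin_cases i; exacts [H.1, H.2])
  rcases hv' with h0 | h1
  · refine ⟨u 0 / v 0, funext fun i => ?_⟩
    fin_cases i <;> simp <;> field_simp
    linear_combination hd
  · refine ⟨u 1 / v 1, funext fun i => ?_⟩
    fin_cases i <;> simp <;> field_simp
    linear_combination -hd

/-- An element of `SL₂` with three fixed points on the projective line is central. -/
lemma commute_of_three_fixed {g : SL(2, F)} {p q r : ℙ F (Fin 2 → F)}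
    (hpq : p ≠ q) (hpr : p ≠ r) (hqr : q ≠ r)
    (hp : g • p = p) (hq : g • q = q) (hr : g • r = r) (h : SL(2, F)) : Commute g h := by
  induction p using Projectivization.ind with
  | _ u hu =>
  induction q using Projectivization.ind with
  | _ v hv =>
  induction r using Projectivization.ind with
  | _ w hw =>
  have form {v : Fin 2 → F} (hv : v ≠ 0)
      (hf : g • Projectivization.mk F v hv = Projectivization.mk F v hv) :
      g.1 1 0 * v 0 ^ 2 + (g.1 1 1 - g.1 0 0) * (v 0 * v 1) - g.1 0 1 * v 1 ^ 2 = 0 := by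
    obtain ⟨a, ha⟩ := exists_eigenvalue_of_smul_eq hv hf
    have h0 := congrFun ha 0
    have h1 := congrFun ha 1
    simp only [Matrix.SpecialLinearGroup.smul_def, Matrix.smul_eq_mulVec, Matrix.mulVec,
      dotProduct, Fin.sum_univ_two, Pi.smul_apply, Units.smul_def, smul_eq_mul] at h0 h1
    linear_combination v 0 * h1 - v 1 * h0
  have fu := form hu hp
  have fv := form hv hq
  have fw := form hw hr
  have hD : (u 0 * v 1 - u 1 * v 0) * (u 0 * w 1 - u 1 * w 0) * (v 0 * w 1 - v 1 * w 0) ≠ 0 :=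
    mul_ne_zero (mul_ne_zero (det_ne_zero_of_mk_ne hpq) (det_ne_zero_of_mk_ne hpr))
      (det_ne_zero_of_mk_ne hqr)
  have h10 : g.1 1 0 = 0 := by
    refine (mul_eq_zero.1 ?_).resolve_right hD
    linear_combination v 1 * w 1 * (v 0 * w 1 - v 1 * w 0) * fu
      - u 1 * w 1 * (u 0 * w 1 - u 1 * w 0) * fv + u 1 * v 1 * (u 0 * v 1 - u 1 * v 0) * fw
  have h01 : g.1 0 1 = 0 := by
    refine (mul_eq_zero.1 ?_).resolve_right hD
    linear_combination -(v 0 * w 0 * (v 0 * w 1 - v 1 * w 0) * fu)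
      + u 0 * w 0 * (u 0 * w 1 - u 1 * w 0) * fv - u 0 * v 0 * (u 0 * v 1 - u 1 * v 0) * fw
  have h11 : g.1 1 1 = g.1 0 0 := by
    refine sub_eq_zero.1 ((mul_eq_zero.1 ?_).resolve_right hD)
    linear_combination -((v 0 ^ 2 * w 1 ^ 2 - v 1 ^ 2 * w 0 ^ 2) * fu)
      + (u 0 ^ 2 * w 1 ^ 2 - u 1 ^ 2 * w 0 ^ 2) * fv
      - (u 0 ^ 2 * v 1 ^ 2 - u 1 ^ 2 * v 0 ^ 2) * fw
  refine Subtype.ext ?_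
  change g.1 * h.1 = h.1 * g.1
  ext i j
  fin_cases i <;> fin_cases j <;>
    simp [Matrix.mul_apply, Fin.sum_univ_two, h10, h01, h11, mul_comm]

lemma card_projectiveLine [Fintype F] :
    Nat.card (ℙ F (Fin 2 → F)) = Fintype.card F + 1 := by
  rw [Projectivization.card_of_finrank_two F (Fin 2 → F) (by simp), Nat.card_eq_fintype_card]

end SpecialLinear

/-- Pigeonhole: a map from a set of size `M ≥ 2 p` to a set of size `p` has many collisions. -/
lemma sq_le_card_collisions {ι P : Type*} [Fintype ι] [Fintype P] [DecidableEq ι] [DecidableEq P]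
    (h : 2 * Fintype.card P ≤ Fintype.card ι) (f : ι → P) :
    Fintype.card ι ^ 2 ≤
      2 * Fintype.card P *
        (Finset.univ.filter fun x : ι × ι => x.1 ≠ x.2 ∧ f x.1 = f x.2).card := by
  classical
  have h1 : ∑ p : P, (Finset.univ.filter fun i => f i = p).card = Fintype.card ι :=
    (Finset.card_eq_sum_card_fiberwise (fun _ _ => Finset.mem_coe.2 (Finset.mem_univ _))).symm
  have h2 : (Finset.univ.filter fun x : ι × ι => f x.1 = f x.2).card =
      ∑ p : P, (Finset.univ.filter fun i => f i = p).card ^ 2 := by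
    rw [Finset.card_eq_sum_card_fiberwise (t := Finset.univ) (f := fun x : ι × ι => f x.1)
      (fun _ _ => Finset.mem_coe.2 (Finset.mem_univ _))]
    refine Finset.sum_congr rfl fun p _ => ?_
    rw [pow_two, ← Finset.card_product]
    congr 1
    ext x
    simp only [Finset.mem_filter, Finset.mem_univ, true_and, Finset.mem_product]
    grind
  have h3 : (Finset.univ.filter fun x : ι × ι => f x.1 = f x.2).card =
      Fintype.card ι +
        (Finset.univ.filter fun x : ι × ι => x.1 ≠ x.2 ∧ f x.1 = f x.2).card := by
    rw [← Finset.card_filter_add_card_filter_not (fun x : ι × ι => x.1 = x.2), Finset.filter_filter,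
      Finset.filter_filter]
    congr 1
    · rw [← Finset.card_univ (α := ι), ← Finset.diag_card (s := Finset.univ)]
      congr 1
      ext ⟨a, b⟩
      simp only [Finset.mem_filter, Finset.mem_univ, true_and, Finset.mem_diag]
      exact ⟨And.right, fun h => ⟨congrArg f h, h⟩⟩
    · congr 1
      ext x
      simp [and_comm]
  have h4 : Fintype.card ι ^ 2 ≤ Fintype.card P *
      ∑ p : P, (Finset.univ.filter fun i => f i = p).card ^ 2 := by
    have := sq_sum_le_card_mul_sum_sq (s := (Finset.univ : Finset P))
      (f := fun p => (Finset.univ.filter fun i => f i = p).card)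
    rwa [h1, Finset.card_univ] at this
  rw [← h2, h3] at h4
  nlinarith

/-- Let `G` act on a finite set `P` in such a way that noncentral elements have at most two fixed
points. Then many pairs of differences from two large families in `G` either have a central first
entry or a common fixed point. -/
lemma pow_four_le_card_good {G P ι : Type*} [Group G] [MulAction G P] [Fintype P] [Fintype ι]
    [DecidableEq ι]
    (h2 : 2 ≤ Fintype.card P) (hP : 2 * Fintype.card P ≤ Fintype.card ι)
    (hfix : ∀ g : G, ∀ p q r : P, p ≠ q → p ≠ r → q ≠ r → g • p = p → g • q = q → g • r = r →
      ∀ h, Commute g h)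
    (u v : ι → G) (good : (ι × ι) × (ι × ι) → Prop) [DecidablePred good]
    (hcentral : ∀ i j k l, i ≠ j → k ≠ l → (∀ h, Commute ((u i)⁻¹ * u j) h) →
      good ((i, j), (k, l)))
    (hcommon : ∀ i j k l, i ≠ j → k ≠ l → ∀ p : P, ((u i)⁻¹ * u j) • p = p →
      ((v k)⁻¹ * v l) • p = p → good ((i, j), (k, l))) :
    Fintype.card ι ^ 4 ≤ 8 * Fintype.card P * (Finset.univ.filter good).card := by
  classical
  let fixed (x : ι × ι) : Finset P := Finset.univ.filter fun p => ((u x.1)⁻¹ * u x.2) • p = p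
  let D (x : ι × ι) : Finset (ι × ι) := Finset.univ.filter fun y => good (x, y)
  let S : Finset (ι × ι) := Finset.univ.filter fun x => x.1 ≠ x.2
  have hS : Fintype.card ι ^ 2 ≤ 4 * S.card := by
    have h1 : S.card = Fintype.card ι * Fintype.card ι - Fintype.card ι := by
      rw [← Finset.card_univ, ← Finset.offDiag_card]
      congr 1
      ext x
      simp [S]
    have h3 : Fintype.card ι ≤ Fintype.card ι * Fintype.card ι := Nat.le_mul_self _
    rw [h1, pow_two]
    have h4 : 4 * Fintype.card ι ≤ Fintype.card ι * Fintype.card ι :=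
      Nat.mul_le_mul_right _ (by omega)
    omega
  have hpt (w : ι → G) (p : P) : Fintype.card ι ^ 2 ≤ 2 * Fintype.card P *
      (S.filter fun x => ((w x.1)⁻¹ * w x.2) • p = p).card := by
    refine (sq_le_card_collisions hP fun i => w i • p).trans (le_of_eq ?_)
    congr 2
    ext x
    simp only [S, mul_smul, inv_smul_eq_iff, Finset.mem_filter, Finset.mem_univ, true_and,
      eq_comm (a := w x.2 • p)]
  have hone (x : ι × ι) (hx : x ∈ S) :
      (fixed x).card * Fintype.card ι ^ 2 ≤ 4 * Fintype.card P * (D x).card := by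
    have hx' : x.1 ≠ x.2 := by simpa [S] using hx
    by_cases hc : ∀ h, Commute ((u x.1)⁻¹ * u x.2) h
    · have h1 : S ⊆ D x := fun y hy => by
        simp only [D, Finset.mem_filter, Finset.mem_univ, true_and]
        exact hcentral _ _ _ _ hx' (by simpa [S] using hy) hc
      calc (fixed x).card * Fintype.card ι ^ 2
          ≤ Fintype.card P * (4 * S.card) := Nat.mul_le_mul (Finset.card_le_univ _) hS
        _ ≤ Fintype.card P * (4 * (D x).card) := by gcongr
        _ = _ := by ring
    · rcases (fixed x).eq_empty_or_nonempty with h0 | ⟨p, hp⟩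
      · simp [h0]
      have hle : (fixed x).card ≤ 2 := by
        by_contra! hlt
        obtain ⟨p, hp, q, hq, r, hr, hpq, hpr, hqr⟩ := Finset.two_lt_card.1 hlt
        simp only [fixed, Finset.mem_filter, Finset.mem_univ, true_and] at hp hq hr
        exact hc (hfix _ p q r hpq hpr hqr hp hq hr)
      have h1 : (S.filter fun y => ((v y.1)⁻¹ * v y.2) • p = p) ⊆ D x := fun y hy => by
        simp only [D, S, fixed, Finset.mem_filter, Finset.mem_univ, true_and] at hy hp ⊢
        exact hcommon _ _ _ _ hx' hy.1 p hp hy.2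
      calc (fixed x).card * Fintype.card ι ^ 2
          ≤ 2 * (2 * Fintype.card P * (D x).card) := by
            refine Nat.mul_le_mul hle ((hpt v p).trans ?_)
            gcongr
        _ = _ := by ring
  have hsum : ∑ x ∈ S, (fixed x).card =
      ∑ p : P, (S.filter fun x => ((u x.1)⁻¹ * u x.2) • p = p).card :=
    Finset.sum_card_bipartiteAbove_eq_sum_card_bipartiteBelow
      (fun (x : ι × ι) (p : P) => ((u x.1)⁻¹ * u x.2) • p = p)
  have hfixed : Fintype.card ι ^ 2 ≤ 2 * ∑ x ∈ S, (fixed x).card := by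
    have h1 := Finset.sum_le_sum fun (p : P) (_ : p ∈ Finset.univ) => hpt u p
    rw [Finset.sum_const, Finset.card_univ, smul_eq_mul, ← Finset.mul_sum, ← hsum] at h1
    refine Nat.le_of_mul_le_mul_left (h1.trans (le_of_eq (by ring))) (by omega : 0 < Fintype.card P)
  have hD : ∑ x ∈ S, (D x).card ≤ (Finset.univ.filter good).card := by
    rw [← Finset.card_sigma]
    refine Finset.card_le_card_of_injOn (fun y => (y.1, y.2)) ?_ ?_
    · intro y hy
      simp only [Finset.coe_sigma, Set.mem_sigma_iff, Finset.mem_coe, D, Finset.mem_filter,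
        Finset.mem_univ, true_and] at hy
      simpa using hy.2
    · rintro ⟨a, b⟩ _ ⟨c, d⟩ _ h
      simpa using h
  calc Fintype.card ι ^ 4 = Fintype.card ι ^ 2 * Fintype.card ι ^ 2 := by ring
    _ ≤ 2 * (∑ x ∈ S, (fixed x).card) * Fintype.card ι ^ 2 := by gcongr
    _ = 2 * ∑ x ∈ S, (fixed x).card * Fintype.card ι ^ 2 := by
      rw [mul_assoc, Finset.sum_mul]
    _ ≤ 2 * ∑ x ∈ S, 4 * Fintype.card P * (D x).card :=
      Nat.mul_le_mul_left _ (Finset.sum_le_sum hone)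
    _ = 8 * Fintype.card P * ∑ x ∈ S, (D x).card := by rw [← Finset.mul_sum]; ring
    _ ≤ _ := by gcongr

/-- Greedy covering: if every set of a family has density at least `1 / K`, then few points suffice
to hit all of them. -/
lemma exists_hitting_sequence {ι : Type*} [Fintype ι] [Nonempty ι] [DecidableEq ι] {K : ℕ}
    (hK : 0 < K) (T : Finset (Finset ι)) (hT : ∀ S ∈ T, Fintype.card ι ≤ K * S.card) (m : ℕ) :
    ∃ a : ℕ → ι, (T.filter fun S => ∀ i < m, a i ∉ S).card * K ^ m ≤ (K - 1) ^ m * T.card := by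
  induction m with
  | zero => exact ⟨fun _ => Classical.arbitrary ι, by simp⟩
  | succ m ih =>
    obtain ⟨a, ha⟩ := ih
    set U := T.filter fun S => ∀ i < m, a i ∉ S with hU
    have hpos : 0 < Fintype.card ι := Fintype.card_pos
    have hdouble : ∑ x : ι, (U.filter fun S => x ∈ S).card = ∑ S ∈ U, S.card := by
      have := Finset.sum_card_bipartiteAbove_eq_sum_card_bipartiteBelow (s := Finset.univ) (t := U)
        (fun (x : ι) (S : Finset ι) => x ∈ S)
      simpa [Finset.bipartiteAbove, Finset.bipartiteBelow] using this
    obtain ⟨x, hx⟩ : ∃ x, U.card ≤ K * (U.filter fun S => x ∈ S).card := by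
      by_contra! H
      have h1 : ∑ x : ι, K * (U.filter fun S => x ∈ S).card < ∑ _x : ι, U.card :=
        Finset.sum_lt_sum_of_nonempty Finset.univ_nonempty fun x _ => H x
      rw [← Finset.mul_sum, hdouble, Finset.mul_sum] at h1
      have h2 : ∑ _S ∈ U, Fintype.card ι ≤ ∑ S ∈ U, K * S.card :=
        Finset.sum_le_sum fun S hS => hT S (Finset.mem_filter.1 hS).1
      simp only [Finset.sum_const, smul_eq_mul, Finset.card_univ] at h1 h2
      rw [mul_comm] at h2
      omega
    refine ⟨fun i => if i = m then x else a i, ?_⟩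
    have hnew : (T.filter fun S => ∀ i < m + 1, (if i = m then x else a i) ∉ S) =
        U.filter fun S => x ∉ S := by
      ext S
      simp only [hU, Finset.mem_filter, and_assoc]
      refine and_congr_right fun _ => ⟨fun h => ⟨fun i hi => ?_, ?_⟩, fun h i hi => ?_⟩
      · simpa [hi.ne] using h i (by omega)
      · simpa using h m (by omega)
      · split_ifs with him
        · exact h.2
        · exact h.1 i (by omega)
    rw [hnew]
    have hsplit := Finset.card_filter_add_card_filter_not (s := U) (fun S => x ∈ S)
    obtain ⟨k, rfl⟩ : ∃ k, K = k + 1 := ⟨K - 1, by omega⟩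
    have h3 : (U.filter fun S => x ∉ S).card * (k + 1) ≤ k * U.card := by
      nlinarith
    calc (U.filter fun S => x ∉ S).card * (k + 1) ^ (m + 1)
        = (U.filter fun S => x ∉ S).card * (k + 1) * (k + 1) ^ m := by ring
      _ ≤ k * U.card * (k + 1) ^ m := by gcongr
      _ = k * (U.card * (k + 1) ^ m) := by ring
      _ ≤ k * ((k + 1 - 1) ^ m * T.card) := by gcongr
      _ = (k + 1 - 1) ^ (m + 1) * T.card := by simp; ring

section DenseWords

open scoped LinearAlgebra.Projectivization MatrixGroups commutatorElement

open Classical in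
/-- For every `L ≥ 1` there is a finite family of nontrivial words of length `O(L)` such that any
pair of elements of any sufficiently small `SL(2, F)` satisfies a proportion `≫ 1 / |F|` of them. -/
lemma exists_dense_words {L : ℕ} (hL : 1 ≤ L) :
    ∃ (ι : Type) (_ : Fintype ι) (_ : Nonempty ι) (word : ι → FreeGroup (Fin 2)),
      (∀ i, word i ≠ 1) ∧ (∀ i, (word i).norm ≤ 504 * L) ∧
      ∀ (F : Type) [Field F] [Fintype F], 2 * (Fintype.card F + 1) ≤ 2 ^ L →
        ∀ f : FreeGroup (Fin 2) →* SL(2, F), Fintype.card ι ≤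
          8 * (Fintype.card F + 1) * (Finset.univ.filter fun i => f (word i) = 1).card := by
  obtain ⟨u, v, hu, hv, huv⟩ := exists_families L
  let M := Fin (2 ^ L)
  have hword (x : (M × M) × (M × M)) : ∃ w : FreeGroup (Fin 2), w ≠ 1 ∧ w.norm ≤ 504 * L ∧
      (x.1.1 ≠ x.1.2 → x.2.1 ≠ x.2.2 → ∀ (G : Type) [Group G] (f : FreeGroup (Fin 2) →* G),
        (∀ z, z = 1 ∨ z = f ((u x.1.1)⁻¹ * u x.1.2) ∨ z = f ((v x.2.1)⁻¹ * v x.2.2) →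
          Commute ⁅f ((u x.1.1)⁻¹ * u x.1.2), f ((v x.2.1)⁻¹ * v x.2.2)⁆
            (z * ⁅f ((u x.1.1)⁻¹ * u x.1.2), f ((v x.2.1)⁻¹ * v x.2.2)⁆ * z⁻¹)) → f w = 1) := by
    by_cases h : x.1.1 ≠ x.1.2 ∧ x.2.1 ≠ x.2.2
    · obtain ⟨w, hw, hn, H⟩ := exists_metabelian_word (huv _ _ _ _ h.1 h.2)
      refine ⟨w, hw, hn.trans ?_, fun _ _ => H⟩
      have h1 := FreeGroup.norm_mul_le (u x.1.1)⁻¹ (u x.1.2)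
      have h2 := FreeGroup.norm_mul_le (v x.2.1)⁻¹ (v x.2.2)
      rw [FreeGroup.norm_inv_eq] at h1 h2
      have := hu x.1.1
      have := hu x.1.2
      have := hv x.2.1
      have := hv x.2.2
      omega
    · refine ⟨FreeGroup.of 0, FreeGroup.of_ne_one 0, by rw [FreeGroup.norm_of]; omega,
        fun h1 h2 => absurd ⟨h1, h2⟩ h⟩
  choose word hne hnorm hlaw using hword
  refine ⟨(M × M) × (M × M), inferInstance, inferInstance, word, hne, hnorm, ?_⟩
  intro F _ _ hF f
  have := Fintype.ofFinite (ℙ F (Fin 2 → F))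
  have hP : Fintype.card (ℙ F (Fin 2 → F)) = Fintype.card F + 1 := by
    rw [← Nat.card_eq_fintype_card, card_projectiveLine]
  have hcard : Fintype.card ((M × M) × (M × M)) = Fintype.card M ^ 4 := by
    simp only [Fintype.card_prod]
    ring
  rw [hcard, ← hP]
  refine pow_four_le_card_good (G := SL(2, F)) (P := ℙ F (Fin 2 → F)) ?_ ?_
    (fun g p q r hpq hpr hqr hp hq hr => commute_of_three_fixed hpq hpr hqr hp hq hr)
    (fun i => f (u i)) (fun i => f (v i)) _ ?_ ?_
  · rw [hP]
    have := Fintype.card_pos (α := F)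
    omega
  · rw [hP]
    simpa [M] using hF
  · intro i j k l hij hkl h
    refine hlaw ((i, j), (k, l)) hij hkl _ f fun z _ => ?_
    have := commutatorElement_eq_one_iff_commute.2 (h (f ((v k)⁻¹ * v l)))
    simp only [map_mul, map_inv] at this ⊢
    simp [this]
  · intro i j k l hij hkl p hp hq
    refine hlaw ((i, j), (k, l)) hij hkl _ f fun z hz => ?_
    exact commute_commutator_conj_of_smul_eq (by simpa using hp) (by simpa using hq) z hz

end DenseWords

section Constraints

open scoped MatrixGroups

lemma card_specialLinearGroup_two_le (F : Type*) [Field F] [Fintype F] :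
    Nat.card SL(2, F) ≤ Fintype.card F ^ 4 := by
  have h := Nat.card_le_card_of_injective (fun g : SL(2, F) => (g : Matrix (Fin 2) (Fin 2) F))
    Subtype.val_injective
  refine h.trans (le_of_eq ?_)
  change Nat.card (Fin 2 → Fin 2 → F) = _
  simp [← pow_mul]

open Classical in
/-- For fields `F` with `q` elements, at most `q ^ 8` subsets of a given family of words arise as
the set of words killed by some homomorphism to `SL(2, F)`. -/
lemma exists_killed_subsets_of_card {ι : Type} [Fintype ι] (word : ι → FreeGroup (Fin 2)) (q : ℕ) :
    ∃ T : Finset (Finset ι), T.card ≤ q ^ 8 ∧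
      ∀ (F : Type) [Field F] [Fintype F], Fintype.card F = q →
        ∀ f : FreeGroup (Fin 2) →* SL(2, F), (Finset.univ.filter fun i => f (word i) = 1) ∈ T := by
  by_cases h : ∃ (F : Type) (_ : Field F) (_ : Fintype F), Fintype.card F = q
  · obtain ⟨E, _, _, hE⟩ := h
    have := Fintype.ofFinite SL(2, E)
    refine ⟨Finset.univ.image fun p : SL(2, E) × SL(2, E) =>
      Finset.univ.filter fun i => FreeGroup.lift ![p.1, p.2] (word i) = 1, ?_, ?_⟩
    · refine Finset.card_image_le.trans ?_
      have h4 := card_specialLinearGroup_two_le E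
      rw [Nat.card_eq_fintype_card, hE] at h4
      calc _ = Fintype.card SL(2, E) * Fintype.card SL(2, E) := by
            rw [Finset.card_univ, Fintype.card_prod]
        _ ≤ q ^ 4 * q ^ 4 := Nat.mul_le_mul h4 h4
        _ = q ^ 8 := by ring
    · intro F _ _ hF f
      let e : F ≃+* E := FiniteField.ringEquivOfCardEq (hF.trans hE.symm)
      let φ : SL(2, F) →* SL(2, E) := Matrix.SpecialLinearGroup.map (e : F →+* E)
      have hφ : Function.Injective φ := fun g h hgh => by
        ext i j
        exact e.injective (congrFun (congrFun (congrArg Subtype.val hgh) i) j)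
      refine Finset.mem_image.2 ⟨(φ (f (FreeGroup.of 0)), φ (f (FreeGroup.of 1))),
        Finset.mem_univ _, ?_⟩
      have hlift : FreeGroup.lift ![φ (f (FreeGroup.of 0)), φ (f (FreeGroup.of 1))] = φ.comp f := by
        ext i : 1
        fin_cases i <;> simp
      ext i
      simp only [hlift, Finset.mem_filter, Finset.mem_univ, true_and, MonoidHom.comp_apply]
      exact map_eq_one_iff φ hφ
  · exact ⟨∅, by simp, fun F _ _ hF => absurd ⟨F, ‹_›, ‹_›, hF⟩ h⟩

open Classical in
lemma exists_killed_subsets {ι : Type} [Fintype ι] (word : ι → FreeGroup (Fin 2)) (N : ℕ) :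
    ∃ T : Finset (Finset ι), T.card ≤ (N + 1) ^ 9 ∧
      ∀ (F : Type) [Field F] [Fintype F], Fintype.card F ≤ N →
        ∀ f : FreeGroup (Fin 2) →* SL(2, F), (Finset.univ.filter fun i => f (word i) = 1) ∈ T := by
  choose T hT hmem using exists_killed_subsets_of_card word
  refine ⟨(Finset.range (N + 1)).biUnion T, ?_, ?_⟩
  · refine (Finset.card_biUnion_le_card_mul _ _ ((N + 1) ^ 8) fun q hq => ?_).trans (le_of_eq ?_)
    · exact (hT q).trans (Nat.pow_le_pow_left (Finset.mem_range.1 hq).le 8)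
    · rw [Finset.card_range]
      ring
  · intro F _ _ hF f
    exact Finset.mem_biUnion.2 ⟨_, Finset.mem_range.2 (Nat.lt_succ_of_le hF), hmem _ F rfl f⟩

lemma two_mul_pow_le_succ_pow (k : ℕ) : 2 * k ^ (k + 1) ≤ (k + 1) ^ (k + 1) := by
  have h (n : ℕ) : (k + n) * k ^ n ≤ k * (k + 1) ^ n := by
    induction n with
    | zero => simp
    | succ n ih =>
      calc (k + (n + 1)) * k ^ (n + 1) = k * (k + n + 1) * k ^ n := by ring
        _ ≤ (k + n) * (k + 1) * k ^ n := Nat.mul_le_mul_right _ (by nlinarith)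
        _ = (k + n) * k ^ n * (k + 1) := by ring
        _ ≤ k * (k + 1) ^ n * (k + 1) := Nat.mul_le_mul_right _ ih
        _ = k * (k + 1) ^ (n + 1) := by ring
  rcases k.eq_zero_or_pos with rfl | hk
  · simp
  refine Nat.le_of_mul_le_mul_left (le_trans ?_ (h (k + 1))) hk
  rw [← mul_assoc]
  exact Nat.mul_le_mul_right _ (by omega)

lemma pred_pow_mul_two_pow_lt {K : ℕ} (hK : 0 < K) (r : ℕ) :
    (K - 1) ^ (K * (r + 1)) * 2 ^ r < K ^ (K * (r + 1)) := by
  obtain ⟨k, rfl⟩ : ∃ k, K = k + 1 := ⟨K - 1, by omega⟩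
  have h := Nat.pow_le_pow_left (two_mul_pow_le_succ_pow k) (r + 1)
  rw [mul_pow, ← pow_mul, ← pow_mul] at h
  rw [Nat.add_sub_cancel]
  have hpos : 0 < (k + 1) ^ ((k + 1) * (r + 1)) := by positivity
  rw [pow_succ] at h
  nlinarith

lemma two_pow_clog_le {m : ℕ} (hm : 1 < m) : 2 ^ Nat.clog 2 m ≤ 2 * m := by
  have h := Nat.pow_pred_clog_lt_self one_lt_two hm
  have hpos : 0 < Nat.clog 2 m := Nat.clog_pos one_lt_two hm
  have : 2 ^ Nat.clog 2 m = 2 * 2 ^ (Nat.clog 2 m).pred := by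
    rw [← pow_succ', Nat.pred_eq_sub_one, Nat.sub_add_cancel hpos]
  omega

/-- A common law of length `O(N² L³)` for all `SL(2, F)` with `|F| ≤ N`. -/
lemma exists_short_law {N L : ℕ} (hL : 1 ≤ L) (hN : 2 * (N + 1) ≤ 2 ^ L) :
    ∃ w : FreeGroup (Fin 2), w ≠ 1 ∧ w.norm ≤ 12953600 * (N + 1) ^ 2 * L ^ 3 ∧
      ∀ (F : Type) [Field F] [Fintype F], Fintype.card F ≤ N →
        ∀ f : FreeGroup (Fin 2) →* SL(2, F), f w = 1 := by
  classical
  obtain ⟨ι, _, _, word, hne, hnorm, hdense⟩ := exists_dense_words hL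
  obtain ⟨T, hT, hmem⟩ := exists_killed_subsets word N
  have hK : 0 < 8 * (N + 1) := by omega
  obtain ⟨a, ha⟩ := exists_hitting_sequence hK
    (T.filter fun S => Fintype.card ι ≤ 8 * (N + 1) * S.card)
    (fun S hS => (Finset.mem_filter.1 hS).2) (8 * (N + 1) * (9 * L + 1))
  set m := 8 * (N + 1) * (9 * L + 1) with hm
  obtain ⟨w, hw, hwn, hlaw⟩ := exists_common_consequence_of_family (504 * L) (Nat.clog 2 m)
    (fun i => word (a i)) (fun _ => hne _) (fun _ => hnorm _)
  refine ⟨w, hw, ?_, ?_⟩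
  · have hm1 : 1 < m := by nlinarith
    have h2 := two_pow_clog_le hm1
    calc w.norm ≤ 4 ^ Nat.clog 2 m * (504 * L + 2) := by omega
      _ = (2 ^ Nat.clog 2 m) ^ 2 * (504 * L + 2) := by rw [← pow_mul, mul_comm _ 2, pow_mul]; rfl
      _ ≤ (2 * m) ^ 2 * (506 * L) := by
        gcongr
        omega
      _ ≤ (2 * (8 * (N + 1) * (10 * L))) ^ 2 * (506 * L) := by
        rw [hm]
        gcongr
        omega
      _ = 12953600 * (N + 1) ^ 2 * L ^ 3 := by ring
  · intro F _ _ hF f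
    refine hlaw _ f ?_
    by_contra! H
    have hcard : (T.filter fun S => Fintype.card ι ≤ 8 * (N + 1) * S.card).card ≤ 2 ^ (9 * L) := by
      refine (Finset.card_filter_le _ _).trans (hT.trans ?_)
      rw [mul_comm, pow_mul]
      exact Nat.pow_le_pow_left (by omega) 9
    have hlt := ha.trans_lt
      ((Nat.mul_le_mul_left _ hcard).trans_lt (pred_pow_mul_two_pow_lt hK (9 * L)))
    have hzero := Nat.lt_of_mul_lt_mul_right (hlt.trans_eq (one_mul _).symm)
    rw [Nat.lt_one_iff, Finset.card_eq_zero, Finset.filter_eq_empty_iff] at hzero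
    refine hzero (x := Finset.univ.filter fun i => f (word i) = 1)
      (Finset.mem_filter.2 ⟨hmem F hF f, ?_⟩) fun i hi h => ?_
    · refine (hdense F (by omega) f).trans ?_
      gcongr
    · exact H i (hi.trans_le (Nat.le_pow_clog one_lt_two m)) (Finset.mem_filter.1 h).2

end Constraints

section ProjectiveLinear

open scoped MatrixGroups

lemma card_pow_three_le_two_mul_card_specialLinearGroup (F : Type*) [Field F] [Fintype F] :
    Fintype.card F ^ 3 ≤ 2 * Nat.card SL(2, F) := by
  classical
  let g (x : Fˣ × F × F) : SL(2, F) :=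
    ⟨!![(x.1 : F), x.2.1; x.2.2, (x.1 : F)⁻¹ * (1 + x.2.1 * x.2.2)], by
      rw [Matrix.det_fin_two_of]
      field_simp
      ring⟩
  have hg : Function.Injective g := fun x y h => by
    have h' (i j : Fin 2) := congrFun (congrFun (congrArg Subtype.val h) i) j
    exact Prod.ext (Units.ext (h' 0 0)) (Prod.ext (h' 0 1) (h' 1 0))
  have h := Nat.card_le_card_of_injective g hg
  rw [Nat.card_prod, Nat.card_prod, Nat.card_eq_fintype_card (α := F),
    Nat.card_eq_fintype_card (α := Fˣ), Fintype.card_units] at h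
  obtain ⟨k, hk⟩ : ∃ k, Fintype.card F = k + 2 :=
    ⟨Fintype.card F - 2, by have := Fintype.one_lt_card (α := F); omega⟩
  rw [hk] at h ⊢
  rw [show k + 2 - 1 = k + 1 by omega] at h
  refine le_trans ?_ (Nat.mul_le_mul_left 2 h)
  nlinarith [Nat.zero_le (k ^ 3), Nat.zero_le (k ^ 2)]

lemma card_pow_three_le_four_mul_card_PSL (F : Type) [Field F] [Fintype F] :
    Fintype.card F ^ 3 ≤ 4 * Nat.card (PSL 2 F) := by
  have h := card_pow_three_le_two_mul_card_specialLinearGroup F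
  rw [Subgroup.card_eq_card_quotient_mul_card_subgroup (Subgroup.center SL(2, F))] at h
  have hc : Nat.card (Subgroup.center SL(2, F)) ≤ 2 := by
    rw [Nat.card_congr Matrix.SpecialLinearGroup.center_equiv_rootsOfUnity.toEquiv]
    have : NeZero (max (Fintype.card (Fin 2)) 1) := ⟨by simp⟩
    exact (card_rootsOfUnity F _).trans (by simp)
  have := Nat.mul_le_mul_left (Nat.card (PSL 2 F)) hc
  change _ ≤ 2 * (Nat.card (PSL 2 F) * _) at h
  omega

/-- A word killed by all homomorphisms from a free group to `G` is killed by all homomorphisms to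
quotients of `G`. -/
lemma FreeGroup.map_eq_one_of_quotient {α G : Type*} [Group G] {K : Subgroup G} [K.Normal]
    {w : FreeGroup α} (h : ∀ f : FreeGroup α →* G, f w = 1) (f : FreeGroup α →* G ⧸ K) :
    f w = 1 := by
  choose g hg using fun a => QuotientGroup.mk'_surjective K (f (FreeGroup.of a))
  have hf : f = (QuotientGroup.mk' K).comp (FreeGroup.lift g) := by
    ext a
    simpa using (hg a).symm
  rw [hf, MonoidHom.comp_apply, h, _root_.map_one]

lemma exists_law_PSL {n N L : ℕ} (hL : 1 ≤ L) (hN : 2 * (N + 1) ≤ 2 ^ L)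
    (hn : ∀ q, q ^ 3 ≤ 4 * n → q ≤ N) :
    ∃ w : FreeGroup (Fin 2), w ≠ 1 ∧ w.norm ≤ 12953600 * (N + 1) ^ 2 * L ^ 3 ∧
      ∀ (G : Type) [Group G] [Fintype G], Nat.card G ≤ n →
        (∃ (F : Type) (_ : Field F) (_ : Fintype F), Nonempty (G ≃* PSL 2 F)) → IsLaw G w := by
  obtain ⟨w, hw, hnorm, hlaw⟩ := exists_short_law hL hN
  refine ⟨w, hw, hnorm, ?_⟩
  rintro G _ _ hG ⟨F, _, _, ⟨e⟩⟩ f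
  have hq : Fintype.card F ≤ N := by
    refine hn _ ((card_pow_three_le_four_mul_card_PSL F).trans ?_)
    rw [← Nat.card_congr e.toEquiv]
    omega
  refine (map_eq_one_iff e e.injective).1 ?_
  exact FreeGroup.map_eq_one_of_quotient (hlaw F hq) (e.toMonoidHom.comp f)

end ProjectiveLinear

lemma exists_cube_bound {n : ℕ} (hn : 2 ≤ n) :
    ∃ N : ℕ, 1 ≤ N ∧ N ^ 3 ≤ 4 * n ∧ ∀ q, q ^ 3 ≤ 4 * n → q ≤ N := by
  refine ⟨Nat.findGreatest (fun k => k ^ 3 ≤ 4 * n) (4 * n), ?_, ?_, fun q hq => ?_⟩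
  · exact Nat.le_findGreatest (by omega) (by omega)
  · exact Nat.findGreatest_spec (P := fun k => k ^ 3 ≤ 4 * n) (m := 0) (by omega) (by omega)
  · exact Nat.le_findGreatest ((Nat.le_self_pow three_ne_zero q).trans hq) hq

lemma sq_le_rpow_of_cube_le {n N : ℕ} (h : N ^ 3 ≤ 4 * n) :
    (N : ℝ) ^ 2 ≤ 4 * (n : ℝ) ^ ((2 : ℝ) / 3) := by
  have h1 : ((N : ℝ) ^ 3) ≤ 4 * n := by exact_mod_cast h
  calc (N : ℝ) ^ 2 = ((N : ℝ) ^ 3) ^ ((2 : ℝ) / 3) := by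
        rw [← Real.rpow_natCast, ← Real.rpow_natCast, ← Real.rpow_mul (by positivity)]
        norm_num
    _ ≤ (4 * n : ℝ) ^ ((2 : ℝ) / 3) := by gcongr
    _ = (4 : ℝ) ^ ((2 : ℝ) / 3) * (n : ℝ) ^ ((2 : ℝ) / 3) :=
        Real.mul_rpow (by norm_num) (by positivity)
    _ ≤ 4 * (n : ℝ) ^ ((2 : ℝ) / 3) := by
        gcongr
        exact Real.rpow_le_self_of_one_le (by norm_num) (by norm_num)

lemma clog_le_ten_mul_log {n N : ℕ} (hn : 2 ≤ n) (hN : 1 ≤ N) (h : N ^ 3 ≤ 4 * n) :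
    (Nat.clog 2 (2 * (N + 1)) : ℝ) ≤ 10 * Real.log n := by
  have h1 : 2 ^ Nat.clog 2 (2 * (N + 1)) ≤ n ^ 6 := by
    have h2 : 2 ^ Nat.clog 2 (2 * (N + 1)) ≤ 2 * (2 * (N + 1)) :=
      two_pow_clog_le (by omega)
    have h3 : N ≤ 4 * n := (Nat.le_self_pow three_ne_zero N).trans h
    have h4 : 2 ^ 5 * n ≤ n ^ 5 * n := Nat.mul_le_mul_right _ (Nat.pow_le_pow_left hn 5)
    rw [pow_succ n 5]
    omega
  have h2 : Real.log (2 ^ Nat.clog 2 (2 * (N + 1))) ≤ Real.log ((n : ℝ) ^ 6) :=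
    Real.log_le_log (by positivity) (by exact_mod_cast h1)
  rw [Real.log_pow, Real.log_pow] at h2
  push_cast at h2
  have := Real.log_two_gt_d9
  have h3 : (0 : ℝ) ≤ Nat.clog 2 (2 * (N + 1)) := by positivity
  nlinarith

theorem statement16 :
    ∃ C : ℝ, 0 < C ∧ ∀ n : ℕ, 2 ≤ n →
      ∃ w : FreeGroup (Fin 2), w ≠ 1 ∧
        (w.toWord.length : ℝ) ≤ C * (n : ℝ) ^ ((2 : ℝ) / 3) * Real.log n ^ 3 ∧
        ∀ (G : Type) [Group G] [Fintype G], Nat.card G ≤ n →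
          (∃ (F : Type) (_ : Field F) (_ : Fintype F), Nonempty (G ≃* PSL 2 F)) →
          IsLaw G w := by
  refine ⟨12953600 * 16 * 1000, by norm_num, fun n hn => ?_⟩
  obtain ⟨N, hN, hNn, hmax⟩ := exists_cube_bound hn
  obtain ⟨w, hw, hnorm, hlaw⟩ := exists_law_PSL
    (Nat.clog_pos one_lt_two (by omega)) (Nat.le_pow_clog one_lt_two (2 * (N + 1))) hmax
  refine ⟨w, hw, ?_, hlaw⟩
  have h1 := sq_le_rpow_of_cube_le hNn
  have h2 := clog_le_ten_mul_log hn hN hNn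
  have h3 : ((N : ℝ) + 1) ^ 2 ≤ 16 * (n : ℝ) ^ ((2 : ℝ) / 3) := by
    have : (1 : ℝ) ≤ N := by exact_mod_cast hN
    nlinarith
  calc (w.toWord.length : ℝ)
      ≤ 12953600 * ((N : ℝ) + 1) ^ 2 * (Nat.clog 2 (2 * (N + 1)) : ℝ) ^ 3 := by
        exact_mod_cast hnorm
    _ ≤ 12953600 * (16 * (n : ℝ) ^ ((2 : ℝ) / 3)) * (10 * Real.log n) ^ 3 := by gcongr
    _ = 12953600 * 16 * 1000 * (n : ℝ) ^ ((2 : ℝ) / 3) * Real.log n ^ 3 := by ring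
end
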